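/- arXiv:2106.12418 — 2 statements merged into one kernel-verified Lean document; each statement's English description precedes it below -/
import Mathlib

section
/- Let X be a regular curve and f : X → X a monotone continuous map. For every x ∈ X_∞ = ⋂_{n ≥ 0} f^n(X) that is not a periodic point of f, the α-limit set α_f(x) is a minimal set of f. -/
open Set Filter Metric Topology Function

/-- A regular curve: every point has arbitrarily small open neighborhoods
with finite topological boundary (to be used on a compact connected
nonempty metric space, i.e. a continuum). -/
def IsRegCurve (X : Type*) [TopologicalSpace X] : Prop :=
  ∀ (x : X) (V : Set X), IsOpen V → x ∈ V →
    ∃ U : Set X, IsOpen U ∧ x ∈ U ∧ U ⊆ V ∧ (frontier U).Finite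

/-- A monotone continuous self-map: continuous and preimages of connected
sets are connected. -/
def IsMonotoneMap {X : Type*} [TopologicalSpace X] (f : X → X) : Prop :=
  Continuous f ∧ ∀ C : Set X, IsPreconnected C → IsPreconnected (f ⁻¹' C)

/-- The ω-limit set of a point: ⋂ₙ closure {f^k(x) : k ≥ n}. -/
def omegaLimitSet {X : Type*} [TopologicalSpace X] (f : X → X) (x : X) : Set X :=
  ⋂ n : ℕ, closure ((fun k => f^[k] x) '' Set.Ici n)

/-- The α-limit set of a point: ⋂ₖ closure (⋃_{n ≥ k} f⁻ⁿ({x})). -/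
def alphaLimitSet {X : Type*} [TopologicalSpace X] (f : X → X) (x : X) : Set X :=
  ⋂ k : ℕ, closure (⋃ n ∈ Set.Ici k, f^[n] ⁻¹' {x})

/-- limsup of a sequence of sets: ⋂ₖ closure (⋃_{n ≥ k} G n). -/
def limsupSet {X : Type*} [TopologicalSpace X] (G : ℕ → Set X) : Set X :=
  ⋂ k : ℕ, closure (⋃ n ∈ Set.Ici k, G n)

/-- A minimal set of `f`: nonempty, closed, invariant, and with no proper
nonempty closed invariant subset. -/
def IsMinimalSet {X : Type*} [TopologicalSpace X] (f : X → X) (M : Set X) : Prop :=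
  M.Nonempty ∧ IsClosed M ∧ f '' M ⊆ M ∧
    ∀ A : Set X, A ⊆ M → A.Nonempty → IsClosed A → f '' A ⊆ A → A = M

/-- A periodic point of `f`. -/
def IsPeriodicPoint {X : Type*} (f : X → X) (x : X) : Prop :=
  ∃ n : ℕ, 1 ≤ n ∧ f^[n] x = x

/-- The set of limit (cluster) points of a sequence. -/
def seqLimitPoints {X : Type*} [TopologicalSpace X] (u : ℕ → X) : Set X :=
  {y : X | MapClusterPt y Filter.atTop u}


theorem aux_L1 {X : Type*} [TopologicalSpace X] {S U : Set X} (hS : IsPreconnected S)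
    (h1 : (S ∩ U).Nonempty) (h2 : (S ∩ Uᶜ).Nonempty) : (S ∩ frontier U).Nonempty := by
  by_contra hne
  rw [Set.not_nonempty_iff_eq_empty] at hne
  have hmiss : ∀ y ∈ S, y ∉ frontier U := fun y hy hy' => by
    have : y ∈ S ∩ frontier U := ⟨hy, hy'⟩
    rw [hne] at this; exact this
  have hcov : S ⊆ interior U ∪ (closure U)ᶜ := by
    intro y hy
    by_cases hc : y ∈ closure U
    · left
      by_contra hi
      exact hmiss y hy ⟨hc, hi⟩
    · right; exact hc
  have hd : Disjoint (interior U) (closure U)ᶜ :=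
    Set.disjoint_left.2 fun y hy hy' => hy' (subset_closure (interior_subset hy))
  rcases hS.subset_or_subset isOpen_interior isClosed_closure.isOpen_compl hd hcov with h | h
  · obtain ⟨y, hy, hy'⟩ := h2
    exact hy' (interior_subset (h hy))
  · obtain ⟨y, hy, hy'⟩ := h1
    exact h hy (subset_closure hy')

theorem aux_L2 {X : Type*} [MetricSpace X] [CompactSpace X] (hX : IsRegCurve X)
    {E D : Set X} (hE : IsClosed E) (hD : IsClosed D) (hED : Disjoint E D) :
    ∃ F : Finset X, ∀ S : Set X, IsPreconnected S → (S ∩ E).Nonempty → (S ∩ D).Nonempty →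
      (S ∩ (F : Set X)).Nonempty := by
  have key : ∃ U : Set X, E ⊆ U ∧ U ⊆ Dᶜ ∧ (frontier U).Finite := by
    have hloc : ∀ y : E, ∃ U, IsOpen U ∧ (y : X) ∈ U ∧ U ⊆ Dᶜ ∧ (frontier U).Finite := fun y =>
      hX y Dᶜ hD.isOpen_compl (Set.disjoint_left.1 hED y.2)
    choose U hUo hyU hUD hUf using hloc
    obtain ⟨t, ht⟩ := hE.isCompact.elim_finite_subcover U hUo
      (fun y hy => Set.mem_iUnion.2 ⟨⟨y, hy⟩, hyU _⟩)
    refine ⟨⋃ i ∈ t, U i, ht, by simpa using fun i hi _ => hUD ⟨i, hi⟩, ?_⟩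
    clear ht
    classical
    induction t using Finset.induction_on with
    | empty => simp
    | insert a s ha ih =>
      rw [Finset.set_biUnion_insert]
      refine Set.Finite.subset ((hUf a).union ih) ?_
      intro z hz
      rcases frontier_union_subset _ _ hz with h | h
      · exact Or.inl h.1
      · exact Or.inr h.2
  obtain ⟨U, hEU, hUD, hf⟩ := key
  refine ⟨hf.toFinset, fun S hS h1 h2 => ?_⟩
  have := aux_L1 (U := U) hS (h1.mono (Set.inter_subset_inter_right _ hEU))
    (h2.mono (Set.inter_subset_inter_right _ (fun z hz hz' => hUD hz' hz)))
  simpa using this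

theorem aux_L3 {X : Type*} [MetricSpace X] [CompactSpace X] [ConnectedSpace X]
    (hX : IsRegCurve X) {η : X} {V : Set X} (hV : IsOpen V) (hη : η ∈ V) :
    ∃ K : Set X, IsPreconnected K ∧ IsClosed K ∧ K ∈ 𝓝 η ∧ K ⊆ V ∧ (frontier K).Finite := by
  obtain ⟨W, hWo, hηW, hWV⟩ : ∃ W, IsOpen W ∧ η ∈ W ∧ closure W ⊆ V := by
    obtain ⟨T, hT, hTc, hTV⟩ := exists_mem_nhds_isClosed_subset (hV.mem_nhds hη)
    obtain ⟨W, hWT, hWo, hW⟩ := _root_.mem_nhds_iff.1 hT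
    exact ⟨W, hWo, hW, (closure_minimal hWT hTc).trans hTV⟩
  obtain ⟨U, hUo, hηU, hUW, hUf⟩ := hX η W hWo hηW
  have hUV : closure U ⊆ V := (closure_mono hUW).trans hWV
  let Y := closure U
  have hYc : IsClosed Y := isClosed_closure
  have : CompactSpace Y := isCompact_iff_compactSpace.1 hYc.isCompact
  let e : Y := ⟨η, subset_closure hηU⟩
  -- clopen C with C ∩ frontier U ⊆ component
  have hsep : ∀ b : Y, ∃ C : Set Y, IsClopen C ∧ e ∈ C ∧ (b ∈ C → b ∈ connectedComponent e) := by
    intro b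
    by_cases hb : b ∈ connectedComponent e
    · exact ⟨Set.univ, isClopen_univ, trivial, fun _ => hb⟩
    · rw [connectedComponent_eq_iInter_isClopen] at hb
      simp only [Set.mem_iInter, not_forall] at hb
      obtain ⟨⟨s, hs, hes⟩, hb⟩ := hb
      exact ⟨s, hs, hes, fun h => absurd h hb⟩
  choose C hC heC hCb using hsep
  have hFfin : (((↑) : Y → X) ⁻¹' (frontier U)).Finite :=
    hUf.preimage Subtype.val_injective.injOn
  let C0 : Set Y := ⋂ b ∈ (((↑) : Y → X) ⁻¹' (frontier U)), C b
  have hC0 : IsClopen C0 := hFfin.isClopen_biInter (fun b _ => hC b)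
  have heC0 : e ∈ C0 := Set.mem_iInter₂.2 fun b _ => heC b
  have hC0b : ∀ b ∈ C0, (b : X) ∈ frontier U → b ∈ connectedComponent e := fun b hb hbF =>
    hCb b (Set.mem_iInter₂.1 hb b hbF)
  have hsub : C0 ⊆ connectedComponent e := by
    rw [connectedComponent_eq_iInter_isClopen]
    intro z hz
    simp only [Set.mem_iInter]
    rintro ⟨D, hD, heD⟩
    by_contra hzD
    have hE : IsClopen (C0 \ D) := hC0.diff hD
    have hEU : ∀ w ∈ C0 \ D, (w : X) ∈ U := by
      rintro w ⟨hw, hwD⟩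
      by_contra hwU
      have hwF : (w : X) ∈ frontier U := ⟨w.2, by rwa [hUo.interior_eq]⟩
      have := hC0b w hw hwF
      exact hwD (hD.connectedComponent_subset heD this)
    have hEX : IsClopen (((↑) : Y → X) '' (C0 \ D)) := by
      refine ⟨hYc.isClosedEmbedding_subtypeVal.isClosedMap _ hE.1, ?_⟩
      obtain ⟨O, hO, hOE⟩ := isOpen_induced_iff.1 hE.2
      have : ((↑) : Y → X) '' (C0 \ D) = O ∩ U := by
        ext w
        constructor
        · rintro ⟨w, hw, rfl⟩
          refine ⟨?_, hEU w hw⟩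
          rw [← hOE] at hw; exact hw
        · rintro ⟨hwO, hwU⟩
          refine ⟨⟨w, subset_closure hwU⟩, ?_, rfl⟩
          rw [← hOE]; exact hwO
      rw [this]; exact hO.inter hUo
    rcases isClopen_iff.1 hEX with h | h
    · have : (z : X) ∈ ((↑) : Y → X) '' (C0 \ D) := ⟨z, ⟨hz, hzD⟩, rfl⟩
      rw [h] at this; exact this
    · have : η ∈ ((↑) : Y → X) '' (C0 \ D) := by rw [h]; trivial
      obtain ⟨w, hw, hwη⟩ := this
      have : w = e := Subtype.ext hwη
      exact hw.2 (this ▸ heD)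
  have hEq : connectedComponent e = C0 :=
    Set.Subset.antisymm (hC0.connectedComponent_subset heC0) hsub
  obtain ⟨O, hO, hOE⟩ := isOpen_induced_iff.1 hC0.2
  have hKO : ∀ w ∈ U, w ∈ O → w ∈ ((↑) : Y → X) '' C0 := fun w hwU hwO => by
    refine ⟨⟨w, subset_closure hwU⟩, ?_, rfl⟩
    rw [← hOE]; exact hwO
  have hOK : ∀ w : Y, w ∈ C0 → (w : X) ∈ O := fun w hw => by
    rw [← hOE] at hw; exact hw
  have hKc : IsClosed (((↑) : Y → X) '' C0) := hYc.isClosedEmbedding_subtypeVal.isClosedMap _ hC0.1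
  refine ⟨((↑) : Y → X) '' C0, ?_, hKc, ?_, ?_, ?_⟩
  · rw [← hEq]
    exact isPreconnected_connectedComponent.image _ continuous_subtype_val.continuousOn
  · exact _root_.mem_nhds_iff.2 ⟨O ∩ U, fun w hw => hKO w hw.2 hw.1, hO.inter hUo, hOK e heC0, hηU⟩
  · rintro _ ⟨w, _, rfl⟩
    exact hUV w.2
  · refine hUf.subset ?_
    rintro z hz
    have hzK := hKc.frontier_subset hz
    obtain ⟨w, hw, rfl⟩ := hzK
    refine ⟨w.2, fun hi => hz.2 ?_⟩
    exact mem_interior.2 ⟨O ∩ U, fun w hw => hKO w hw.2 hw.1, hO.inter hUo, hOK w hw,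
      interior_subset hi⟩

theorem aux_L4 {X ι : Type*} (F : Finset X) (T : Finset ι) (B : ι → Set X)
    (hd : ∀ i ∈ T, ∀ j ∈ T, i ≠ j → Disjoint (B i) (B j))
    (hm : ∀ i ∈ T, (B i ∩ (F : Set X)).Nonempty) : T.card ≤ F.card := by
  rcases T.eq_empty_or_nonempty with rfl | ⟨i0, hi0⟩
  · simp
  have : Nonempty X := ⟨(hm i0 hi0).some⟩
  choose! g hg using hm
  refine Finset.card_le_card_of_injOn g (fun i hi => (hg i hi).2) ?_
  intro i hi j hj hij
  by_contra hne
  exact Set.disjoint_left.1 (hd i hi j hj hne) (hg i hi).1 (hij ▸ (hg j hj).1)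

theorem aux_pre {X : Type*} [TopologicalSpace X] {f : X → X} (hf : IsMonotoneMap f) (n : ℕ)
    {C : Set X} (hC : IsPreconnected C) : IsPreconnected (f^[n] ⁻¹' C) := by
  induction n with
  | zero => simpa using hC
  | succ n ih =>
    rw [Function.iterate_succ, Set.preimage_comp]
    exact hf.2 _ ih

theorem aux_L5 {X : Type*} (f : X → X) (F : Finset X) (K0 : Set X)
    (h : ∀ l : ℕ, ∃ K ⊆ K0, ∃ j, l < j ∧
      (∀ e, j ≤ e + l → e < j → Disjoint (f^[e] ⁻¹' K) K0) ∧
      (f^[j] ⁻¹' K ∩ (F : Set X)).Nonempty) : False := by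
  choose K hK j hj hdis hne using h
  let J : ℕ → ℕ := fun t => j^[t] 0
  have hJs : ∀ t, J (t + 1) = j (J t) := fun t => Function.iterate_succ_apply' j t 0
  have hJm : StrictMono J := strictMono_nat_of_lt_succ fun t => by rw [hJs]; exact hj _
  have hdd : ∀ s t, s < t → Disjoint (f^[J (s + 1)] ⁻¹' K (J s)) (f^[J (t + 1)] ⁻¹' K (J t)) := by
    intro s t hst
    rw [Set.disjoint_left]
    intro z hz hz'
    have h1 : J (s + 1) ≤ J t := hJm.monotone hst
    have h2 : J t < J (t + 1) := hJm (Nat.lt_succ_self t)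
    have h3 : 0 < J (s + 1) := lt_of_le_of_lt (Nat.zero_le _) (hJm (Nat.lt_succ_self s))
    have h4 : J (t + 1) = (J (t + 1) - J (s + 1)) + J (s + 1) := by omega
    have := hdis (J t) (J (t + 1) - J (s + 1)) (by rw [← hJs]; omega) (by rw [← hJs]; omega)
    refine Set.disjoint_left.1 this (?_ : f^[J (s + 1)] z ∈ _) (hK _ hz)
    rw [Set.mem_preimage, ← Function.iterate_add_apply, ← h4]
    exact hz'
  have := aux_L4 F (Finset.range (F.card + 1)) (fun t => f^[J (t + 1)] ⁻¹' K (J t))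
    (fun s _ t _ hst => by
      rcases lt_or_gt_of_ne hst with h | h
      · exact hdd s t h
      · exact (hdd t s h).symm)
    (fun t _ => by
      have := hne (J t)
      rw [← hJs] at this
      exact this)
  simp at this

theorem aux_L7 {X : Type*} [TopologicalSpace X] {f : X → X} (hf : IsMonotoneMap f) {O : Set X}
    (hO : IsPreconnected O) (hfr : (frontier O).Finite)
    (hno : ∀ j, 1 ≤ j → ¬ f^[j] ⁻¹' O ⊆ O)
    (hunb : ∀ n, ∃ j, n ≤ j ∧ (f^[j] ⁻¹' O ∩ O).Nonempty) :
    ∃ l : ℕ, ∀ n, ∃ j, n ≤ j ∧ j ≤ n + l ∧ (f^[j] ⁻¹' O ∩ O).Nonempty := by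
  classical
  by_contra hcon
  push Not at hcon
  refine aux_L5 f hfr.toFinset O fun l => ?_
  obtain ⟨n, hn⟩ := hcon l
  have hj := Nat.find_spec (hunb n)
  have hmin : ∀ e, e < Nat.find (hunb n) → ¬ (n ≤ e ∧ (f^[e] ⁻¹' O ∩ O).Nonempty) :=
    fun e he => Nat.find_min (hunb n) he
  generalize Nat.find (hunb n) = j at hj hmin
  have hlt : n + l < j := by
    by_contra hle
    have h1 := hn j hj.1 (by omega)
    exact hj.2.ne_empty h1
  refine ⟨O, subset_rfl, j, by omega, fun e he hej => ?_, ?_⟩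
  · rw [Set.disjoint_iff_inter_eq_empty, ← Set.not_nonempty_iff_eq_empty]
    exact fun h => hmin e hej ⟨by omega, h⟩
  · obtain ⟨z, hz, hz'⟩ := Set.not_subset.1 (hno j (by omega))
    have := aux_L1 (U := O) (aux_pre hf j hO) hj.2 ⟨z, hz, hz'⟩
    simpa using this

/-- Nonempty-ness of windows for the backward fibres. -/
theorem aux_L8 {X : Type*} [TopologicalSpace X] {f : X → X} (hf : Continuous f) {x : X}
    {A D : Set X} (hA : A ⊆ alphaLimitSet f x) (hne : A.Nonempty) (hinv : f '' A ⊆ A)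
    (hD : A ⊆ interior D) (L n0 : ℕ) :
    ∃ a, n0 ≤ a ∧ ∀ i, i ≤ L → (f^[a + i] ⁻¹' {x} ∩ D).Nonempty := by
  obtain ⟨z, hz⟩ := hne
  have hit : ∀ h, f^[h] z ∈ A := by
    intro h
    induction h with
    | zero => exact hz
    | succ h ih => rw [Function.iterate_succ_apply']; exact hinv ⟨_, ih, rfl⟩
  have hO : IsOpen (⋂ h ∈ Finset.range (L + 1), f^[h] ⁻¹' (interior D)) :=
    isOpen_biInter_finset fun h _ => isOpen_interior.preimage (hf.iterate h)
  have hzO : z ∈ (⋂ h ∈ Finset.range (L + 1), f^[h] ⁻¹' (interior D)) :=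
    Set.mem_iInter₂.2 fun h _ => hD (hit h)
  have hzc := Set.mem_iInter.1 (hA hz) (n0 + L)
  obtain ⟨w, hw, hw'⟩ := mem_closure_iff.1 hzc _ hO hzO
  obtain ⟨v, hv, hwv⟩ := Set.mem_iUnion₂.1 hw'
  have hv' : n0 + L ≤ v := hv
  refine ⟨v - L, by omega, fun i hi => ⟨f^[L - i] w, ?_, ?_⟩⟩
  · rw [Set.mem_preimage, ← Function.iterate_add_apply]
    have : v - L + i + (L - i) = v := by omega
    rw [this]; exact hwv
  · have := Set.mem_iInter₂.1 hw (L - i) (Finset.mem_range.2 (by omega))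
    exact interior_subset this

theorem aux_disj {X : Type*} {f : X → X} {x : X} (hper : ¬ IsPeriodicPoint f x) {m n : ℕ}
    (hmn : m ≠ n) : Disjoint (f^[m] ⁻¹' {x}) (f^[n] ⁻¹' {x}) := by
  wlog h : m < n generalizing m n
  · exact (this hmn.symm (by omega)).symm
  rw [Set.disjoint_left]
  intro z hz hz'
  apply hper
  refine ⟨n - m, by omega, ?_⟩
  have h1 : f^[m] z = x := hz
  have h2 : f^[n] z = x := hz'
  rw [← h1, ← Function.iterate_add_apply, Nat.sub_add_cancel h.le, h2, h1]

theorem aux_L9 {X : Type*} [TopologicalSpace X] {f : X → X} (hf : IsMonotoneMap f) {x : X}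
    (hper : ¬ IsPeriodicPoint f x) {y : X} (hy : y ∈ alphaLimitSet f x) {K : Set X}
    (hK : K ∈ 𝓝 y) (hfr : (frontier K).Finite) (n0 : ℕ) :
    ∃ p, n0 ≤ p ∧ f^[p] ⁻¹' {x} ⊆ K := by
  by_contra hcon
  push Not at hcon
  have hmeet : ∀ n, ∃ p, n ≤ p ∧ (f^[p] ⁻¹' {x} ∩ K).Nonempty := by
    intro n
    have hyc := Set.mem_iInter.1 hy n
    obtain ⟨w, hw, hw'⟩ := mem_closure_iff_nhds.1 hyc K hK
    obtain ⟨v, hv, hwv⟩ := Set.mem_iUnion₂.1 hw'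
    exact ⟨v, hv, w, hwv, hw⟩
  have hinf : {p | n0 ≤ p ∧ (f^[p] ⁻¹' {x} ∩ K).Nonempty}.Infinite := by
    rw [Set.infinite_iff_exists_gt]
    intro n
    obtain ⟨p, hp, h⟩ := hmeet (n0 + n + 1)
    exact ⟨p, ⟨by omega, h⟩, by omega⟩
  obtain ⟨T, hT, hTc⟩ := hinf.exists_subset_card_eq (hfr.toFinset.card + 1)
  have := aux_L4 hfr.toFinset T (fun p => f^[p] ⁻¹' {x}) (fun i _ j _ hij => aux_disj hper hij)
    (fun p hp => by
      obtain ⟨hp1, hp2⟩ := hT hp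
      obtain ⟨z, hz, hz'⟩ := Set.not_subset.1 (hcon p hp1)
      have := aux_L1 (U := K) (aux_pre hf p isPreconnected_singleton) hp2 ⟨z, hz, hz'⟩
      simpa using this)
  omega

theorem aux_fib {X : Type*} {f : X → X} {x : X} {K : Set X} {p : ℕ} (hp : f^[p] ⁻¹' {x} ⊆ K)
    (j : ℕ) : f^[p + j] ⁻¹' {x} ⊆ f^[j] ⁻¹' K := by
  intro z hz
  apply hp
  rw [Set.mem_preimage, ← Function.iterate_add_apply]
  exact hz

theorem aux_wander {X : Type*} [MetricSpace X] {f : X → X} (hf : Continuous f) {η : X}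
    (hη : ¬ IsPeriodicPoint f η) (m : ℕ) :
    ∃ V : Set X, IsOpen V ∧ η ∈ V ∧ ∀ e, 1 ≤ e → e ≤ m → ∀ z ∈ V, f^[e] z ∉ V := by
  have h : ∀ e : ℕ, ∃ W : Set X, IsOpen W ∧ η ∈ W ∧ (1 ≤ e → ∀ z ∈ W, f^[e] z ∉ W) := by
    intro e
    by_cases he : 1 ≤ e
    · have hne : f^[e] η ≠ η := fun h => hη ⟨e, he, h⟩
      obtain ⟨u, v, hu, hv, hηu, hηv, hd⟩ := t2_separation hne
      refine ⟨v ∩ f^[e] ⁻¹' u, hv.inter (hu.preimage (hf.iterate e)), ⟨hηv, hηu⟩, ?_⟩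
      intro _ z hz hz'
      exact Set.disjoint_left.1 hd hz.2 hz'.1
    · exact ⟨Set.univ, isOpen_univ, trivial, fun h => absurd h he⟩
  choose W hW hηW hz using h
  refine ⟨⋂ e ∈ Finset.range (m + 1), W e, isOpen_biInter_finset fun e _ => hW e,
    Set.mem_iInter₂.2 fun e _ => hηW e, fun e he hem z hz1 hz2 => ?_⟩
  have hm : e ∈ Finset.range (m + 1) := Finset.mem_range.2 (by omega)
  exact hz e he z (Set.mem_iInter₂.1 hz1 e hm) (Set.mem_iInter₂.1 hz2 e hm)

theorem aux_L10 {X : Type*} [MetricSpace X] [CompactSpace X] [ConnectedSpace X]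
    (hX : IsRegCurve X) {f : X → X} (hf : IsMonotoneMap f) {x : X}
    (hx : ∀ n, (f^[n] ⁻¹' {x}).Nonempty) (hper : ¬ IsPeriodicPoint f x)
    {A : Set X} (hA : A ⊆ alphaLimitSet f x) (hne : A.Nonempty) (hAc : IsClosed A)
    (hinv : f '' A ⊆ A) {η : X} (hη : η ∈ alphaLimitSet f x) (hηA : η ∉ A)
    (hηp : ¬ IsPeriodicPoint f η) : False := by
  classical
  obtain ⟨u, huo, hAu, hu⟩ := normal_exists_closure_subset hAc
    (isClosed_singleton (x := η)).isOpen_compl (fun z hz hz' => hηA (by rwa [← (hz' : z = η)]))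
  have hAD : A ⊆ interior (closure u) :=
    hAu.trans (interior_maximal subset_closure huo)
  have hηD : η ∈ (closure u)ᶜ := fun h => hu h rfl
  have hDc : IsClosed (closure u) := isClosed_closure
  generalize closure u = D at hAD hηD hDc
  obtain ⟨K0, hK0p, hK0c, hK0n, hK0D, -⟩ := aux_L3 hX hDc.isOpen_compl hηD
  obtain ⟨F, hF⟩ := aux_L2 hX hK0c hDc (Set.disjoint_left.2 fun z hz => hK0D hz)
  refine aux_L5 f F K0 fun l => ?_
  obtain ⟨V, hVo, hηV, hV⟩ := aux_wander hf.1 hηp ((F.card + 1) * (l + 1))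
  obtain ⟨K, hKp, hKc, hKn, hKV, hKf⟩ := aux_L3 hX (hVo.inter isOpen_interior)
    (⟨hηV, mem_interior_iff_mem_nhds.2 hK0n⟩ : η ∈ V ∩ interior K0)
  have hKK0 : K ⊆ K0 := fun z hz => interior_subset (hKV hz).2
  have hKw : ∀ e, 1 ≤ e → e ≤ (F.card + 1) * (l + 1) → ∀ z ∈ K, f^[e] z ∉ K :=
    fun e h1 h2 z hz hz' => hV e h1 h2 z (hKV hz).1 (hKV hz').1
  obtain ⟨p, -, hp⟩ := aux_L9 hf hper hη hKn hKf 0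
  have hunb : ∀ n, ∃ j, n ≤ j ∧ (f^[j] ⁻¹' K ∩ K).Nonempty := by
    intro n
    obtain ⟨p', hp'1, hp'⟩ := aux_L9 hf hper hη hKn hKf (p + n)
    refine ⟨p' - p, by omega, ?_⟩
    obtain ⟨z, hz⟩ := hx p'
    refine ⟨z, ?_, hp' hz⟩
    apply aux_fib hp
    rwa [show p + (p' - p) = p' by omega]
  have hno : ∀ j, 1 ≤ j → ¬ f^[j] ⁻¹' K ⊆ K := by
    intro j hj hsub
    have hall : ∀ m, f^[p + m * j] ⁻¹' {x} ⊆ K := by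
      intro m
      induction m with
      | zero => simpa using hp
      | succ m ih =>
        have := aux_fib ih j
        rw [show p + (m + 1) * j = p + m * j + j by ring]
        exact this.trans hsub
    obtain ⟨a, ha, hwin⟩ := aux_L8 hf.1 hA hne hinv hAD j p
    have h1 := Nat.div_add_mod (a - p) j
    have h2 := Nat.mod_lt (a - p) (show j > 0 by omega)
    obtain ⟨z, hz, hzD⟩ := hwin (j - (a - p) % j) (by omega)
    have h3 : a + (j - (a - p) % j) = p + ((a - p) / j + 1) * j := by
      rw [add_mul, one_mul, mul_comm]; omega
    rw [h3] at hz
    exact hK0D (hKK0 (hall _ hz)) hzD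
  obtain ⟨l', hl'⟩ := aux_L7 hf hKp hKf hno hunb
  obtain ⟨a, ha, hwin⟩ := aux_L8 hf.1 hA hne hinv hAD ((F.card + 1) * (l + 1) + l') p
  obtain ⟨a', rfl⟩ := Nat.exists_eq_add_of_le ha
  have hwF : ∀ j, a' ≤ j → j ≤ a' + ((F.card + 1) * (l + 1) + l') →
      (f^[j] ⁻¹' K ∩ K0).Nonempty → (f^[j] ⁻¹' K ∩ (F : Set X)).Nonempty := by
    intro j h1 h2 h3
    refine hF _ (aux_pre hf j hKp) h3 ?_
    obtain ⟨z, hz, hzD⟩ := hwin (j - a') (by omega)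
    refine ⟨z, ?_, hzD⟩
    apply aux_fib hp
    rwa [show p + j = p + a' + (j - a') by omega]
  have hblock : ∃ b, b ≤ F.card ∧ ∀ j, a' + b * (l + 1) ≤ j → j < a' + (b + 1) * (l + 1) →
      ¬ (f^[j] ⁻¹' K ∩ K0).Nonempty := by
    by_contra hcon
    push Not at hcon
    choose! g hg1 hg2 hg3 using hcon
    have hdd : ∀ b c, b < c → c ≤ F.card →
        Disjoint (f^[g b] ⁻¹' K) (f^[g c] ⁻¹' K) := by
      intro b c hbc hc
      rw [Set.disjoint_left]
      intro z hz hz'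
      have e1 := hg2 b (by omega)
      have e2 := hg1 c hc
      have e3 := hg2 c hc
      have e4 := hg1 b (by omega)
      have e5 : (b + 1) * (l + 1) ≤ c * (l + 1) := Nat.mul_le_mul_right _ hbc
      have e6 : (c + 1) * (l + 1) ≤ (F.card + 1) * (l + 1) := Nat.mul_le_mul_right _ (by omega)
      refine hKw (g c - g b) (by omega) (by omega) _ hz ?_
      rw [← Function.iterate_add_apply, Nat.sub_add_cancel (by omega)]
      exact hz'
    have := aux_L4 F (Finset.range (F.card + 1)) (fun b => f^[g b] ⁻¹' K)
      (fun b hb c hc hbc => by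
        have hb' := Finset.mem_range.1 hb
        have hc' := Finset.mem_range.1 hc
        rcases lt_or_gt_of_ne hbc with h | h
        · exact hdd b c h (by omega)
        · exact (hdd c b h (by omega)).symm)
      (fun b hb => by
        have hb' := Finset.mem_range.1 hb
        have e1 := hg1 b (by omega)
        have e2 := hg2 b (by omega)
        have e6 : (b + 1) * (l + 1) ≤ (F.card + 1) * (l + 1) := Nat.mul_le_mul_right _ (by omega)
        exact hwF _ (by omega) (by omega) (hg3 b (by omega)))
    simp at this
  obtain ⟨b, hb, hbe⟩ := hblock
  have e6 : (b + 1) * (l + 1) ≤ (F.card + 1) * (l + 1) := Nat.mul_le_mul_right _ (by omega)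
  have e7 : (b + 1) * (l + 1) = b * (l + 1) + (l + 1) := by ring
  rw [e7] at hbe e6
  obtain ⟨j0, hj01, hj02, hj03⟩ := hl' (a' + b * (l + 1))
  have hex : ∃ j, a' + b * (l + 1) ≤ j ∧ (f^[j] ⁻¹' K ∩ K0).Nonempty :=
    ⟨j0, hj01, hj03.mono (Set.inter_subset_inter_right _ hKK0)⟩
  have hj := Nat.find_spec hex
  have hjle : Nat.find hex ≤ j0 :=
    Nat.find_min' hex ⟨hj01, hj03.mono (Set.inter_subset_inter_right _ hKK0)⟩
  have hmin : ∀ e, e < Nat.find hex →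
      ¬ (a' + b * (l + 1) ≤ e ∧ (f^[e] ⁻¹' K ∩ K0).Nonempty) :=
    fun e he => Nat.find_min hex he
  generalize Nat.find hex = j at hj hjle hmin
  have hlt : a' + (b * (l + 1) + (l + 1)) ≤ j := by
    by_contra hle
    exact hbe j hj.1 (by omega) hj.2
  refine ⟨K, hKK0, j, by omega, fun e he hej => ?_, hwF j (by omega) (by omega) hj.2⟩
  rw [Set.disjoint_iff_inter_eq_empty, ← Set.not_nonempty_iff_eq_empty]
  exact fun h => hmin e hej ⟨by omega, h⟩

theorem aux_L11 {X : Type*} [MetricSpace X] [CompactSpace X] [ConnectedSpace X]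
    (hX : IsRegCurve X) {f : X → X} (hf : IsMonotoneMap f) {x : X}
    (hper : ¬ IsPeriodicPoint f x)
    {A : Set X} (hA : A ⊆ alphaLimitSet f x) (hne : A.Nonempty)
    (hinv : f '' A ⊆ A) (hall : ∀ y ∈ alphaLimitSet f x, y ∉ A → IsPeriodicPoint f y)
    {K0 D : Set X} (hK0 : IsClosed K0) (hD : IsClosed D) (hAD : A ⊆ interior D)
    (hKD : Disjoint K0 D) : (K0 ∩ alphaLimitSet f x).Finite := by
  classical
  by_contra hinf
  obtain ⟨F, hF⟩ := aux_L2 hX hK0 hD hKD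
  obtain ⟨T, hT, hTc⟩ := Set.Infinite.exists_subset_card_eq hinf (F.card + 1)
  obtain ⟨U, hU, hUd⟩ := T.finite_toSet.t2_separation
  have hC := fun y => aux_L3 hX (hU y).2 (hU y).1
  choose C hCp hCc hCn hCU hCf using hC
  have hu : ∀ y ∈ T, ∃ p, 0 ≤ p ∧ f^[p] ⁻¹' {x} ⊆ C y := fun y hy =>
    aux_L9 hf hper (hT hy).2 (hCn y) (hCf y) 0
  choose! u _ hu using hu
  have hn : ∀ y ∈ T, IsPeriodicPoint f y := fun y hy =>
    hall y (hT hy).2 fun hyA => Set.disjoint_left.1 hKD (hT hy).1 (interior_subset (hAD hyA))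
  choose! n hn1 hn2 using hn
  have hq : 0 < ∏ y ∈ T, n y := Finset.prod_pos fun y hy => hn1 y hy
  have hqd : ∀ y ∈ T, n y ∣ ∏ y ∈ T, n y := fun y hy => Finset.dvd_prod_of_mem n hy
  generalize (∏ y ∈ T, n y) = q at hq hqd
  obtain ⟨a, -, hwin⟩ := aux_L8 hf.1 hA hne hinv hAD (q + ∑ y ∈ T, u y) 0
  have h1 := Nat.div_add_mod a q
  have h2 := Nat.mod_lt a hq
  have hle : ∀ y ∈ T, u y ≤ ∑ y ∈ T, u y := fun y hy =>
    Finset.single_le_sum (f := u) (fun _ _ => Nat.zero_le _) hy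
  have hi : ∃ i, q ∣ i ∧ a ≤ i ∧ i ≤ a + q := by
    refine ⟨q * (a / q) + q, ⟨a / q + 1, by ring⟩, by omega, by omega⟩
  obtain ⟨i, hqi, hi1, hi2⟩ := hi
  have := aux_L4 F T (fun y => f^[i] ⁻¹' C y)
    (fun y hy z hz hyz => by
      refine Disjoint.preimage _ ?_
      exact (hUd hy hz hyz).mono (hCU y) (hCU z))
    (fun y hy => by
      refine hF _ (aux_pre hf i (hCp y)) ⟨y, ?_, (hT hy).1⟩ ?_
      · have : Function.IsPeriodicPt f i y :=
          Function.IsPeriodicPt.trans_dvd (hn2 y hy) ((hqd y hy).trans hqi)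
        rw [Set.mem_preimage, this]
        exact mem_of_mem_nhds (hCn y)
      · have := hle y hy
        obtain ⟨z, hz, hzD⟩ := hwin (u y + i - a) (by omega)
        refine ⟨z, ?_, hzD⟩
        apply aux_fib (hu y hy)
        rwa [show u y + i = a + (u y + i - a) by omega])
  omega

theorem aux_inv {X : Type*} [TopologicalSpace X] {f : X → X} (hf : Continuous f) (x : X) :
    f '' alphaLimitSet f x ⊆ alphaLimitSet f x := by
  rintro _ ⟨y, hy, rfl⟩
  refine Set.mem_iInter.2 fun k => ?_
  have h1 := Set.mem_iInter.1 hy (k + 1)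
  refine closure_mono ?_ (image_closure_subset_closure_image hf ⟨y, h1, rfl⟩)
  rintro _ ⟨w, hw, rfl⟩
  obtain ⟨v, hv, hwv⟩ := Set.mem_iUnion₂.1 hw
  have hv' : k + 1 ≤ v := hv
  refine Set.mem_iUnion₂.2 ⟨v - 1, (by simp; omega), ?_⟩
  rw [Set.mem_preimage, ← Function.iterate_succ_apply, Nat.succ_eq_add_one,
    Nat.sub_add_cancel (by omega)]
  exact hwv

theorem aux_main {X : Type*} [MetricSpace X] [CompactSpace X] [ConnectedSpace X]
    (hX : IsRegCurve X) {f : X → X} (hf : IsMonotoneMap f) {x : X}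
    (hx : ∀ n, (f^[n] ⁻¹' {x}).Nonempty) (hper : ¬ IsPeriodicPoint f x)
    (hαc : IsClosed (alphaLimitSet f x))
    {A : Set X} (hA : A ⊆ alphaLimitSet f x) (hne : A.Nonempty) (hAc : IsClosed A)
    (hinv : f '' A ⊆ A) : alphaLimitSet f x ⊆ A := by
  intro a ha
  by_contra haA
  have hall : ∀ y ∈ alphaLimitSet f x, y ∉ A → IsPeriodicPoint f y := fun y hy hyA => by
    by_contra hyp
    exact aux_L10 hX hf hx hper hA hne hAc hinv hy hyA hyp
  have hαit : ∀ k, f^[k] a ∈ alphaLimitSet f x := by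
    intro k
    induction k with
    | zero => exact ha
    | succ k ih => rw [Function.iterate_succ_apply']; exact aux_inv hf.1 x ⟨_, ih, rfl⟩
  have hAit : ∀ k, ∀ y ∈ A, f^[k] y ∈ A := by
    intro k y hy
    induction k with
    | zero => exact hy
    | succ k ih => rw [Function.iterate_succ_apply']; exact hinv ⟨_, ih, rfl⟩
  obtain ⟨n, hn1, hn⟩ := hall a ha haA
  have hnp : Function.IsPeriodicPt f n a := hn
  have hback : ∀ k, ∃ m, f^[m] (f^[k] a) = a := by
    intro k
    refine ⟨n * k - k, ?_⟩
    rw [← Function.iterate_add_apply, Nat.sub_add_cancel (Nat.le_mul_of_pos_left k hn1)]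
    exact hnp.mul_const k
  have hAk : ∀ k, f^[k] a ∉ A := by
    intro k hk
    obtain ⟨m, hm⟩ := hback k
    exact haA (hm ▸ hAit m _ hk)
  let P : Set X := Set.range fun k => f^[k] a
  have hPfin : P.Finite := by
    refine ((Finset.range n).finite_toSet.image fun k => f^[k] a).subset ?_
    rintro _ ⟨k, rfl⟩
    exact ⟨k % n, by simpa using Nat.mod_lt k hn1, hnp.iterate_mod_apply k⟩
  have hPA : ∀ z ∈ P, z ∉ A := by
    rintro _ ⟨k, rfl⟩; exact hAk k
  have hPc : IsClosed P := hPfin.isClosed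
  obtain ⟨u, huo, hAu, hu⟩ := normal_exists_closure_subset hAc hPc.isOpen_compl
    (fun z hz hz' => hPA z hz' hz)
  obtain ⟨v, hvo, hPv, hv⟩ := normal_exists_closure_subset hPc
    (isClosed_closure (s := u)).isOpen_compl (fun z hz hz' => hu hz' hz)
  have hfin := aux_L11 hX hf hper hA hne hinv hall (isClosed_closure (s := v))
    (isClosed_closure (s := u)) (hAu.trans (interior_maximal subset_closure huo))
    (Set.disjoint_left.2 fun z hz => hv hz)
  have hB2 : IsClosed (alphaLimitSet f x \ P) := by
    have : alphaLimitSet f x \ P =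
        (alphaLimitSet f x \ v) ∪ ((closure v ∩ alphaLimitSet f x) \ P) := by
      ext z
      constructor
      · rintro ⟨h1, h2⟩
        by_cases hz : z ∈ v
        · exact Or.inr ⟨⟨subset_closure hz, h1⟩, h2⟩
        · exact Or.inl ⟨h1, hz⟩
      · rintro (⟨h1, h2⟩ | ⟨⟨h1, h2⟩, h3⟩)
        · exact ⟨h1, fun h => h2 (hPv h)⟩
        · exact ⟨h2, h3⟩
    rw [this]
    exact (hαc.sdiff hvo).union (hfin.subset Set.sdiff_subset).isClosed
  have hB2inv : ∀ y ∈ alphaLimitSet f x \ P, f y ∈ alphaLimitSet f x \ P := by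
    rintro y ⟨hy, hyP⟩
    refine ⟨aux_inv hf.1 x ⟨y, hy, rfl⟩, ?_⟩
    rintro ⟨k, hk⟩
    have hk' : f^[k] a = f y := hk
    by_cases hyA : y ∈ A
    · exact hAk k (hk' ▸ hinv ⟨y, hyA, rfl⟩)
    · obtain ⟨m, hm1, hm⟩ := hall y hy hyA
      refine hyP ⟨m - 1 + k, ?_⟩
      change f^[m - 1 + k] a = y
      rw [Function.iterate_add_apply, hk', ← Function.iterate_succ_apply, Nat.succ_eq_add_one,
        Nat.sub_add_cancel hm1, hm]
  obtain ⟨V1, V2, hV1, hV2, hPV1, hBV2, hVd⟩ := normal_separation hPc hB2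
    (Set.disjoint_left.2 fun z hz hz' => hz'.2 hz)
  have hV2' : IsOpen (V2 ∩ f ⁻¹' V2) := hV2.inter (hV2.preimage hf.1)
  have hanti : ∀ i j : ℕ, i ≤ j → closure (⋃ n ∈ Set.Ici j, f^[n] ⁻¹' {x}) ⊆
      closure (⋃ n ∈ Set.Ici i, f^[n] ⁻¹' {x}) := fun i j hij =>
    closure_mono (Set.biUnion_subset_biUnion_left (Set.Ici_subset_Ici.2 hij))
  obtain ⟨k, hk⟩ := exists_subset_nhds_of_isCompact'
    (V := fun k : ℕ => closure (⋃ n ∈ Set.Ici k, f^[n] ⁻¹' {x}))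
    (U := V1 ∪ (V2 ∩ f ⁻¹' V2))
    (fun i j => ⟨max i j, hanti _ _ (le_max_left _ _), hanti _ _ (le_max_right _ _)⟩)
    (fun i => isClosed_closure.isCompact) (fun i => isClosed_closure)
    (fun z hz => (hV1.union hV2').mem_nhds (by
      have hz' : z ∈ alphaLimitSet f x := hz
      by_cases hzP : z ∈ P
      · exact Or.inl (hPV1 hzP)
      · exact Or.inr ⟨hBV2 ⟨hz', hzP⟩, hBV2 (hB2inv z ⟨hz', hzP⟩)⟩))
  have hVd' : Disjoint V1 (V2 ∩ f ⁻¹' V2) := hVd.mono_right Set.inter_subset_left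
  have hdich : ∀ m, k ≤ m → f^[m] ⁻¹' {x} ⊆ V1 ∨ f^[m] ⁻¹' {x} ⊆ V2 ∩ f ⁻¹' V2 := by
    intro m hm
    refine (aux_pre hf m isPreconnected_singleton).subset_or_subset hV1 hV2' hVd' ?_
    exact fun z hz => hk (subset_closure (Set.mem_iUnion₂.2 ⟨m, hm, hz⟩))
  have hstep : ∀ m, k ≤ m → f^[m] ⁻¹' {x} ⊆ V1 → f^[m + 1] ⁻¹' {x} ⊆ V1 := by
    intro m hm h
    rcases hdich (m + 1) (by omega) with h' | h'
    · exact h'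
    · exfalso
      obtain ⟨w, hw⟩ := hx (m + 1)
      exact Set.disjoint_left.1 hVd (h (show f w ∈ f^[m] ⁻¹' {x} from hw)) (h' hw).2
  have hmeet : ∀ z ∈ alphaLimitSet f x, ∀ W : Set X, IsOpen W → z ∈ W → ∀ m0,
      ∃ m, m0 ≤ m ∧ (f^[m] ⁻¹' {x} ∩ W).Nonempty := by
    intro z hz W hW hzW m0
    obtain ⟨w, hw, hw'⟩ := mem_closure_iff.1 (Set.mem_iInter.1 hz m0) W hW hzW
    obtain ⟨v, hv, hwv⟩ := Set.mem_iUnion₂.1 hw'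
    exact ⟨v, hv, w, hwv, hw⟩
  obtain ⟨m, hm, w, hw, hwV⟩ := hmeet a ha V1 hV1 (hPV1 ⟨0, rfl⟩) k
  have hmV : f^[m] ⁻¹' {x} ⊆ V1 := by
    rcases hdich m hm with h | h
    · exact h
    · exact absurd (h hw) (Set.disjoint_left.1 hVd' hwV)
  have hev : ∀ i, m ≤ i → f^[i] ⁻¹' {x} ⊆ V1 := by
    intro i hi
    induction i, hi using Nat.le_induction with
    | base => exact hmV
    | succ i hi ih => exact hstep i (by omega) ih
  obtain ⟨y, hy⟩ := hne
  obtain ⟨i, hi, w, hw, hwV⟩ := hmeet y (hA hy) V2 hV2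
    (hBV2 ⟨hA hy, fun hyP => hPA y hyP hy⟩) m
  exact Set.disjoint_left.1 hVd (hev i hi hw) hwV

theorem stmt_16 {X : Type*} [MetricSpace X] [CompactSpace X] [ConnectedSpace X]
    (hX : IsRegCurve X) (f : X → X) (hf : IsMonotoneMap f) (x : X)
    (hx : x ∈ ⋂ n : ℕ, Set.range (f^[n]))
    (hper : ¬ IsPeriodicPoint f x) :
    IsMinimalSet f (alphaLimitSet f x) := by
  have hx' : ∀ n, (f^[n] ⁻¹' {x}).Nonempty := fun n => by
    obtain ⟨y, hy⟩ := Set.mem_iInter.1 hx n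
    exact ⟨y, hy⟩
  have hcl : IsClosed (alphaLimitSet f x) := isClosed_iInter fun k => isClosed_closure
  refine ⟨?_, hcl, aux_inv hf.1 x, fun A hA hne hAc hinv =>
    Set.Subset.antisymm hA (aux_main hX hf hx' hper hcl hA hne hAc hinv)⟩
  refine IsCompact.nonempty_iInter_of_sequence_nonempty_isCompact_isClosed _ ?_ ?_ ?_ ?_
  · exact fun i => closure_mono (Set.biUnion_subset_biUnion_left
      (Set.Ici_subset_Ici.2 (Nat.le_succ i)))
  · intro i
    obtain ⟨y, hy⟩ := hx' i
    exact ⟨y, subset_closure (Set.mem_iUnion₂.2 ⟨i, Set.mem_Ici.2 le_rfl, hy⟩)⟩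
  · exact isClosed_closure.isCompact
  · exact fun i => isClosed_closure
end

section
/- Let X be a regular curve, f : X → X a monotone continuous map, and x ∈ X a point that is not periodic. Then for every negative orbit (x_n)_{n ≥ 0} of x, the α-limit set α_f(x) equals the set α_f((x_n)_n) of limit points of the sequence (x_n)_{n ≥ 0}. -/
open Set Filter Metric Topology Function

theorem stmt_18_key {X : Type*} [MetricSpace X] [CompactSpace X]
    (hX : IsRegCurve X) (f : X → X) (hf : IsMonotoneMap f) (x : X)
    (hper : ¬ IsPeriodicPoint f x) (u : ℕ → X) (hun : ∀ n : ℕ, f^[n] (u n) = x)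
    (ε : ℝ) (hε : 0 < ε) :
    ∀ᶠ n in atTop, ∀ y, f^[n] y = x → dist y (u n) < ε := by
  have hconn : ∀ n : ℕ, IsPreconnected (f^[n] ⁻¹' {x}) := by
    intro n
    induction n with
    | zero => simpa using isPreconnected_singleton
    | succ n ih =>
      rw [Function.iterate_succ, Set.preimage_comp]
      exact hf.2 _ ih
  have hlt : ∀ (z : X) (m n : ℕ), m < n → f^[m] z = x → f^[n] z = x → False := by
    intro z m n hmn hm hn
    refine hper ⟨n - m, by omega, ?_⟩
    have h : f^[(n - m) + m] z = x := by rw [Nat.sub_add_cancel hmn.le]; exact hn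
    rwa [Function.iterate_add_apply, hm] at h
  choose U hUo hUx hUb hUf using fun p : X =>
    hX p (Metric.ball p (ε / 2)) Metric.isOpen_ball (Metric.mem_ball_self (half_pos hε))
  obtain ⟨t, ht⟩ := CompactSpace.elim_nhds_subcover U (fun p => (hUo p).mem_nhds (hUx p))
  have hfin : (⋃ z ∈ (⋃ p ∈ t, frontier (U p)), {n : ℕ | f^[n] z = x}).Finite := by
    refine Set.Finite.biUnion (t.finite_toSet.biUnion fun p _ => hUf p) fun z _ => ?_
    refine Set.Subsingleton.finite fun m hm n hn => ?_
    rcases lt_trichotomy m n with h | h | h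
    · exact (hlt z m n h hm hn).elim
    · exact h
    · exact (hlt z n m h hn hm).elim
  have hev := hfin.eventually_cofinite_notMem
  rw [Nat.cofinite_eq_atTop] at hev
  filter_upwards [hev] with n hn y hy
  by_contra hd
  apply hn
  have hu : u n ∈ ⋃ p ∈ t, U p := by rw [ht]; trivial
  simp only [Set.mem_iUnion] at hu
  obtain ⟨p, hp, hup⟩ := hu
  have hyU : y ∉ U p := by
    intro hyU
    have h1 := Metric.mem_ball.1 (hUb p hyU)
    have h2 := Metric.mem_ball.1 (hUb p hup)
    have := dist_triangle_right y (u n) p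
    linarith
  have hne : ((f^[n] ⁻¹' {x}) ∩ frontier (U p)).Nonempty := by
    by_contra hemp
    have hcl : ∀ z, f^[n] z = x → z ∉ U p → z ∉ closure (U p) := by
      intro z hz hzU hzc
      exact hemp ⟨z, hz, hzc, fun h => hzU (interior_subset h)⟩
    obtain ⟨z, -, hz1, hz2⟩ := hconn n (U p) (closure (U p))ᶜ (hUo p)
      isClosed_closure.isOpen_compl
      (fun z hz => (em (z ∈ U p)).imp id (hcl z hz))
      ⟨u n, hun n, hup⟩ ⟨y, hy, hcl y hy hyU⟩
    exact hz2 (subset_closure hz1)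
  obtain ⟨z, hz, hzf⟩ := hne
  simp only [Set.mem_iUnion]
  exact ⟨z, ⟨p, hp, hzf⟩, hz⟩

theorem stmt_18 {X : Type*} [MetricSpace X] [CompactSpace X] [ConnectedSpace X]
    (hX : IsRegCurve X) (f : X → X) (hf : IsMonotoneMap f) (x : X)
    (hper : ¬ IsPeriodicPoint f x) (u : ℕ → X)
    (hu0 : u 0 = x) (hu : ∀ n : ℕ, f (u (n + 1)) = u n) :
    alphaLimitSet f x = seqLimitPoints u := by
  have hun : ∀ n : ℕ, f^[n] (u n) = x := by
    intro n
    induction n with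
    | zero => simpa using hu0
    | succ n ih => rw [Function.iterate_succ_apply, hu, ih]
  have key := stmt_18_key hX f hf x hper u hun
  ext y
  simp only [alphaLimitSet, seqLimitPoints, Set.mem_iInter, Set.mem_setOf_eq]
  rw [Metric.nhds_basis_ball.mapClusterPt_iff_frequently]
  constructor
  · intro h ε hε
    rw [frequently_atTop]
    intro k
    obtain ⟨N, hN⟩ := eventually_atTop.1 (key (ε / 2) (half_pos hε))
    obtain ⟨z, hz, hzd⟩ := Metric.mem_closure_iff.1 (h (max k N)) (ε / 2) (half_pos hε)
    simp only [Set.mem_iUnion] at hz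
    obtain ⟨n, hn, hz⟩ := hz
    have hn' : max k N ≤ n := hn
    refine ⟨n, (le_max_left _ _).trans hn', ?_⟩
    have h1 := hN n ((le_max_right _ _).trans hn') z hz
    have h2 := dist_triangle_left (u n) y z
    rw [Metric.mem_ball]
    rw [dist_comm y z] at hzd
    linarith
  · intro h k
    rw [Metric.mem_closure_iff]
    intro ε hε
    obtain ⟨n, hn, hd⟩ := frequently_atTop.1 (h ε hε) k
    refine ⟨u n, ?_, by rw [dist_comm]; exact hd⟩
    simp only [Set.mem_iUnion]
    exact ⟨n, hn, hun n⟩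
end
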